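/- Let σ > 0, y > 0, ε ∈ (0,1) and x > 0. Define BH(x) := exp(−(σ²/y²)·ψ(xy/σ²)) with ψ(v) := (1+v)ln(1+v) − v; PU(x) := inf_{λ>0} exp(−λx + λ²(1−ε)σ²/2 + ((e^{λy}−1−λy)/y²)εσ²); Ca(x) := σ²/(σ²+x²); Be(x) := P₂(y Π̃_{σ²/y²}; x); and Pin(x) := P₃(Γ_{(1−ε)σ²} + y Π̃_{εσ²/y²}; x). Then (I) Pin(x) ≤ PU(x) ≤ BH(x) and Be(x) ≤ min(Ca(x), BH(x)); and (II) Be(x) = Ca(x) for all x ∈ [0,y]. -/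

import Mathlib

open MeasureTheory ProbabilityTheory Real

/-- Law of `Γ_{v} + y * (Π_θ - θ)`. -/
noncomputable def gaussPoissonLaw (v θ y : ℝ) : Measure ℝ :=
  ((gaussianReal 0 v.toNNReal).prod (poissonMeasure θ.toNNReal)).map
    (fun p => p.1 + y * ((p.2 : ℝ) - θ))

/-- Law of `y * (Π_θ - θ)`. -/
noncomputable def centeredPoissonLaw (θ y : ℝ) : Measure ℝ :=
  (poissonMeasure θ.toNNReal).map (fun n : ℕ => y * ((n : ℝ) - θ))

/-- `P_α(ν; x) = inf_{t < x} E(η - t)₊^α / (x - t)^α` for `η` with law `ν`. -/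
noncomputable def Ptail (α : ℝ) (ν : Measure ℝ) (x : ℝ) : ℝ :=
  ⨅ t : Set.Iio x, (∫ z, max (z - (t : ℝ)) 0 ^ α ∂ν) / (x - (t : ℝ)) ^ α

/-- `ψ(v) = (1+v)ln(1+v) - v`. -/
noncomputable def psiBH (v : ℝ) : ℝ := (1 + v) * Real.log (1 + v) - v

/-- The Bennett–Hoeffding bound. -/
noncomputable def BH (σ y x : ℝ) : ℝ := Real.exp (-(σ ^ 2 / y ^ 2) * psiBH (x * y / σ ^ 2))

/-- The Pinelis–Utev bound. -/
noncomputable def PU (σ y ε x : ℝ) : ℝ :=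
  ⨅ l : Set.Ioi (0 : ℝ),
    Real.exp (-(l : ℝ) * x + (l : ℝ) ^ 2 * (1 - ε) * σ ^ 2 / 2 +
      (Real.exp ((l : ℝ) * y) - 1 - (l : ℝ) * y) / y ^ 2 * (ε * σ ^ 2))

/-- The Cantelli bound. -/
noncomputable def Ca (σ x : ℝ) : ℝ := σ ^ 2 / (σ ^ 2 + x ^ 2)

/-- The Bentkus bound `Be(x) = P₂(y Π̃_{σ²/y²}; x)`. -/
noncomputable def Be (σ y x : ℝ) : ℝ := Ptail 2 (centeredPoissonLaw (σ ^ 2 / y ^ 2) y) x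

/-- The bound `Pin(x) = P₃(Γ_{(1-ε)σ²} + y Π̃_{εσ²/y²}; x)`. -/
noncomputable def Pin (σ y ε x : ℝ) : ℝ :=
  Ptail 3 (gaussPoissonLaw ((1 - ε) * σ ^ 2) (ε * σ ^ 2 / y ^ 2) y) x

section

open scoped NNReal Nat

section Ptail

variable {α x : ℝ} {ν : Measure ℝ}

lemma Ptail_term_nonneg (t : Set.Iio x) :
    0 ≤ (∫ z, max (z - (t : ℝ)) 0 ^ α ∂ν) / (x - (t : ℝ)) ^ α :=
  div_nonneg (integral_nonneg fun _ => rpow_nonneg (le_max_right _ _) _)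
    (rpow_nonneg (sub_nonneg.2 (le_of_lt t.2)) _)

lemma Ptail_le {t : ℝ} (ht : t < x) :
    Ptail α ν x ≤ (∫ z, max (z - t) 0 ^ α ∂ν) / (x - t) ^ α :=
  ciInf_le ⟨0, by rintro _ ⟨s, rfl⟩; exact Ptail_term_nonneg s⟩ (⟨t, ht⟩ : Set.Iio x)

lemma Ptail_le_exp (hα : 0 < α) {l : ℝ} (hl : 0 < l)
    (hint : Integrable (fun z => exp (l * z)) ν) :
    Ptail α ν x ≤ exp (-l * x) * ∫ z, exp (l * z) ∂ν := by
  have hαl : 0 < α / l := by positivity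
  refine (Ptail_le (sub_lt_self x hαl)).trans ?_
  rw [sub_sub_cancel, ← integral_div, ← integral_const_mul]
  refine integral_mono_of_nonneg (ae_of_all _ fun z => ?_) (hint.const_mul _)
    (ae_of_all _ fun z => ?_)
  · exact div_nonneg (rpow_nonneg (le_max_right _ _) _) (rpow_nonneg hαl.le _)
  · change max (z - (x - α / l)) 0 ^ α / (α / l) ^ α ≤ exp (-l * x) * exp (l * z)
    rw [← div_rpow (le_max_right _ _) hαl.le, ← exp_add]
    have hbase : max (z - (x - α / l)) 0 / (α / l) ≤ exp (l * (z - x) / α) := by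
      rw [div_le_iff₀ hαl]
      refine max_le ?_ (by positivity)
      have h := add_one_le_exp (l * (z - x) / α)
      calc z - (x - α / l) = (l * (z - x) / α + 1) * (α / l) := by field_simp; ring
        _ ≤ _ := by gcongr
    calc (max (z - (x - α / l)) 0 / (α / l)) ^ α ≤ exp (l * (z - x) / α) ^ α :=
          rpow_le_rpow (div_nonneg (le_max_right _ _) hαl.le) hbase hα.le
      _ = exp (-l * x + l * z) := by
          rw [← exp_mul]
          congr 1
          field_simp
          ring

end Ptail

section Cantelli

variable {ν : Measure ℝ} {σ x : ℝ}

lemma integral_sub_const_sq [IsProbabilityMeasure ν] (hi1 : Integrable (fun z : ℝ => z) ν)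
    (hi2 : Integrable (fun z : ℝ => z ^ 2) ν) (h1 : ∫ z, z ∂ν = 0)
    (h2 : ∫ z, z ^ 2 ∂ν = σ ^ 2) (t : ℝ) :
    Integrable (fun z => (z - t) ^ 2) ν ∧ ∫ z, (z - t) ^ 2 ∂ν = σ ^ 2 + t ^ 2 := by
  have heq : (fun z : ℝ => (z - t) ^ 2) = fun z => z ^ 2 - 2 * t * z + t ^ 2 := by
    ext z; ring
  have hd : Integrable (fun z : ℝ => z ^ 2 - 2 * t * z) ν := hi2.sub (hi1.const_mul (2 * t))
  rw [heq]
  refine ⟨hd.add (integrable_const _), ?_⟩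
  rw [integral_add hd (integrable_const _), integral_sub hi2 (hi1.const_mul _),
    integral_const_mul, h1, h2]
  simp

lemma max_zero_sq_le (u : ℝ) : max u 0 ^ 2 ≤ u ^ 2 := by
  rcases le_total u 0 with h | h <;> simp [h, sq_nonneg]

lemma integrable_posPart_sq {t : ℝ} (h : Integrable (fun z => (z - t) ^ 2) ν) :
    Integrable (fun z => max (z - t) 0 ^ 2) ν :=
  h.mono' (by fun_prop) (ae_of_all _ fun z => by
    rw [norm_of_nonneg (by positivity)]; exact max_zero_sq_le _)

lemma Ptail_two_le_variance_ratio [IsProbabilityMeasure ν] (hi1 : Integrable (fun z : ℝ => z) ν)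
    (hi2 : Integrable (fun z : ℝ => z ^ 2) ν) (h1 : ∫ z, z ∂ν = 0)
    (h2 : ∫ z, z ^ 2 ∂ν = σ ^ 2) {t : ℝ} (ht : t < x) :
    Ptail 2 ν x ≤ (σ ^ 2 + t ^ 2) / (x - t) ^ 2 := by
  obtain ⟨hi, he⟩ := integral_sub_const_sq hi1 hi2 h1 h2 t
  refine (Ptail_le ht).trans ?_
  simp only [rpow_two]
  gcongr
  rw [← he]
  exact integral_mono (integrable_posPart_sq hi) hi fun z => max_zero_sq_le _

lemma Ptail_two_le_Ca [IsProbabilityMeasure ν] (hi1 : Integrable (fun z : ℝ => z) ν)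
    (hi2 : Integrable (fun z : ℝ => z ^ 2) ν) (h1 : ∫ z, z ∂ν = 0)
    (h2 : ∫ z, z ^ 2 ∂ν = σ ^ 2) (hσ : 0 < σ) (hx : 0 ≤ x) :
    Ptail 2 ν x ≤ Ca σ x := by
  rcases hx.eq_or_lt with rfl | hx
  · have hCa : Ca σ 0 = 1 := by simp [Ca, hσ.ne']
    rw [hCa]
    refine le_of_forall_pos_le_add fun δ hδ => ?_
    have hr : 0 < σ / √δ := by positivity
    refine (Ptail_two_le_variance_ratio hi1 hi2 h1 h2 (neg_lt_zero.2 hr)).trans (le_of_eq ?_)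
    rw [zero_sub, neg_neg, neg_sq, div_pow, sq_sqrt hδ.le]
    field_simp
    ring
  · have ht : -(σ ^ 2 / x) < x := by
      have : 0 < σ ^ 2 / x := by positivity
      linarith
    refine (Ptail_two_le_variance_ratio hi1 hi2 h1 h2 ht).trans (le_of_eq ?_)
    have hsub : x - -(σ ^ 2 / x) = (σ ^ 2 + x ^ 2) / x := by
      field_simp
      ring
    rw [hsub, Ca]
    field_simp
    ring

lemma Ca_le_Ptail_two [IsProbabilityMeasure ν] (hi1 : Integrable (fun z : ℝ => z) ν)
    (hi2 : Integrable (fun z : ℝ => z ^ 2) ν) (h1 : ∫ z, z ∂ν = 0)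
    (h2 : ∫ z, z ^ 2 ∂ν = σ ^ 2) (hσ : 0 < σ)
    (hsupp : ∀ᵐ z ∂ν, 0 ≤ σ ^ 2 + x * z) :
    Ca σ x ≤ Ptail 2 ν x := by
  have : Nonempty (Set.Iio x) := Set.nonempty_Iio.to_subtype
  refine le_ciInf fun ⟨t, ht⟩ => ?_
  rw [Set.mem_Iio] at ht
  have hxt : 0 < x - t := sub_pos.2 ht
  have hD : 0 < σ ^ 2 + x ^ 2 := by positivity
  simp only [rpow_two]
  rw [le_div_iff₀ (by positivity)]
  obtain ⟨hi, -⟩ := integral_sub_const_sq hi1 hi2 h1 h2 t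
  set a := (x - t) / (σ ^ 2 + x ^ 2) with ha
  have ha0 : 0 < a := by positivity
  set A := 2 * a * x - a ^ 2 * x ^ 2 with hA
  set B := 2 * a * (σ ^ 2 - x * t) - 2 * a ^ 2 * σ ^ 2 * x with hB
  set C := -(2 * a * σ ^ 2 * t) - a ^ 2 * σ ^ 4 with hC
  have hIAB : Integrable (fun z : ℝ => A * z ^ 2 + B * z) ν :=
    (hi2.const_mul A).add (hi1.const_mul B)
  have hval : ∫ z, A * z ^ 2 + B * z + C ∂ν = Ca σ x * (x - t) ^ 2 := by
    rw [integral_add hIAB (integrable_const _),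
      integral_add (hi2.const_mul A) (hi1.const_mul B), integral_const_mul, integral_const_mul,
      h1, h2]
    simp only [integral_const, probReal_univ, smul_eq_mul, Ca, hA, hC, ha]
    field_simp
    ring
  rw [← hval]
  refine integral_mono_ae (hIAB.add (integrable_const _)) (integrable_posPart_sq hi) ?_
  filter_upwards [hsupp] with z hz
  have hm : z - t ≤ max (z - t) 0 := le_max_left _ _
  have hprod := mul_le_mul_of_nonneg_right hm (mul_nonneg ha0.le hz)
  have heq : A * z ^ 2 + B * z + C =
      2 * ((z - t) * (a * (σ ^ 2 + x * z))) - (a * (σ ^ 2 + x * z)) ^ 2 := by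
    rw [hA, hB, hC]; ring
  rw [heq]
  nlinarith [sq_nonneg (max (z - t) 0 - a * (σ ^ 2 + x * z))]

end Cantelli

section Poisson

lemma hasSum_poisson_shift (r : ℝ≥0) {f : ℕ → ℝ} {S : ℝ}
    (h : HasSum (fun n => exp (-r) * r ^ n / (n)! * f (n + 1)) S) :
    HasSum (fun n => exp (-r) * r ^ n / (n)! * (n * f n)) (r * S) := by
  rw [← hasSum_nat_add_iff' 1]
  have h' := h.mul_left (r : ℝ)
  simp only [Finset.range_one, Finset.sum_singleton, Nat.cast_zero, zero_mul, mul_zero, sub_zero]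
  convert! h' using 2 with n
  rw [Nat.factorial_succ]
  push_cast
  field_simp
  ring

lemma hasSum_poisson_id (r : ℝ≥0) :
    HasSum (fun n : ℕ => exp (-r) * r ^ n / (n)! * (n : ℝ)) r := by
  have h := hasSum_poisson_shift r (f := fun _ => 1) (S := 1)
    (by simpa using hasSum_one_poissonMeasure r)
  simpa using h

lemma hasSum_poisson_sq (r : ℝ≥0) :
    HasSum (fun n : ℕ => exp (-r) * r ^ n / (n)! * (n : ℝ) ^ 2) (r * (r + 1)) := by
  have h := hasSum_poisson_shift r (f := fun n => (n : ℝ)) (S := r + 1) (by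
    convert! (hasSum_poisson_id r).add (hasSum_one_poissonMeasure r) using 2 with n
    push_cast
    ring)
  simpa [sq] using h

lemma hasSum_poisson_exp (r : ℝ≥0) (l : ℝ) :
    HasSum (fun n : ℕ => exp (-r) * r ^ n / (n)! * exp (l * n)) (exp (r * (exp l - 1))) := by
  convert! (NormedSpace.expSeries_div_hasSum_exp ((r : ℝ) * exp l)).mul_left (exp (-r))
    using 1
  · ext n
    rw [mul_pow, ← exp_nat_mul, mul_comm l]
    ring
  · rw [← exp_eq_exp_ℝ, ← exp_add]
    ring_nf

lemma integral_poissonMeasure_of_hasSum {r : ℝ≥0} {f : ℕ → ℝ} {S : ℝ} (hf : ∀ n, 0 ≤ f n)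
    (h : HasSum (fun n => exp (-r) * r ^ n / (n)! * f n) S) :
    Integrable f (poissonMeasure r) ∧ ∫ n, f n ∂(poissonMeasure r) = S := by
  refine ⟨integrable_poissonMeasure_iff.2 ?_, ?_⟩
  · simpa only [norm_of_nonneg (hf _)] using h.summable
  · rw [integral_poissonMeasure]
    exact h.tsum_eq

lemma centeredPoisson_exp {θ : ℝ} (hθ : 0 ≤ θ) (l y : ℝ) :
    Integrable (fun n : ℕ => exp (l * (y * ((n : ℝ) - θ)))) (poissonMeasure θ.toNNReal) ∧
      ∫ n : ℕ, exp (l * (y * ((n : ℝ) - θ))) ∂(poissonMeasure θ.toNNReal) =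
        exp (θ * (exp (l * y) - 1 - l * y)) := by
  refine integral_poissonMeasure_of_hasSum (fun n => (exp_pos _).le) ?_
  have h := (hasSum_poisson_exp θ.toNNReal (l * y)).mul_right (exp (-(l * y * θ)))
  simp only [coe_toNNReal θ hθ] at h ⊢
  convert! h using 1
  · ext n
    rw [mul_assoc, ← exp_add]
    ring_nf
  · rw [← exp_add]
    ring_nf

lemma integrable_exp_centeredPoissonLaw {θ : ℝ} (hθ : 0 ≤ θ) (l y : ℝ) :
    Integrable (fun z => exp (l * z)) (centeredPoissonLaw θ y) :=
  (integrable_map_measure (by fun_prop) .of_discrete).2 (centeredPoisson_exp hθ l y).1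

lemma integral_exp_centeredPoissonLaw {θ : ℝ} (hθ : 0 ≤ θ) (l y : ℝ) :
    ∫ z, exp (l * z) ∂(centeredPoissonLaw θ y) = exp (θ * (exp (l * y) - 1 - l * y)) := by
  rw [centeredPoissonLaw, integral_map .of_discrete (by fun_prop)]
  exact (centeredPoisson_exp hθ l y).2

instance (θ y : ℝ) : IsProbabilityMeasure (centeredPoissonLaw θ y) :=
  Measure.isProbabilityMeasure_map .of_discrete

lemma centeredPoissonLaw_mean {θ : ℝ} (hθ : 0 ≤ θ) (y : ℝ) :
    Integrable (fun z : ℝ => z) (centeredPoissonLaw θ y) ∧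
      ∫ z, z ∂(centeredPoissonLaw θ y) = 0 := by
  obtain ⟨hi, he⟩ := integral_poissonMeasure_of_hasSum (fun n => n.cast_nonneg)
    (hasSum_poisson_id θ.toNNReal)
  refine ⟨(integrable_map_measure (by fun_prop) .of_discrete).2
    ((hi.sub (integrable_const θ)).const_mul y), ?_⟩
  rw [centeredPoissonLaw, integral_map .of_discrete (by fun_prop), integral_const_mul,
    integral_sub hi (integrable_const θ), he]
  simp [hθ]

lemma centeredPoissonLaw_sq {θ : ℝ} (hθ : 0 ≤ θ) (y : ℝ) :
    Integrable (fun z : ℝ => z ^ 2) (centeredPoissonLaw θ y) ∧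
      ∫ z, z ^ 2 ∂(centeredPoissonLaw θ y) = y ^ 2 * θ := by
  obtain ⟨hi, he⟩ := integral_poissonMeasure_of_hasSum (fun n => n.cast_nonneg)
    (hasSum_poisson_id θ.toNNReal)
  obtain ⟨hi2, he2⟩ := integral_poissonMeasure_of_hasSum (fun n => sq_nonneg (n : ℝ))
    (hasSum_poisson_sq θ.toNNReal)
  have heq : (fun n : ℕ => (y * ((n : ℝ) - θ)) ^ 2) =
      fun n : ℕ => y ^ 2 * ((n : ℝ) ^ 2 - 2 * θ * n + θ ^ 2) := by
    ext n; ring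
  have hd : Integrable (fun n : ℕ => (n : ℝ) ^ 2 - 2 * θ * n) (poissonMeasure θ.toNNReal) :=
    hi2.sub (hi.const_mul (2 * θ))
  constructor
  · refine (integrable_map_measure (by fun_prop) .of_discrete).2 ?_
    change Integrable (fun n : ℕ => (y * ((n : ℝ) - θ)) ^ 2) _
    rw [heq]
    exact (hd.add (integrable_const _)).const_mul _
  · rw [centeredPoissonLaw, integral_map .of_discrete (by fun_prop), heq, integral_const_mul,
      integral_add hd (integrable_const _), integral_sub hi2 (hi.const_mul _),
      integral_const_mul, he, he2]
    simp only [coe_toNNReal θ hθ, integral_const, probReal_univ, smul_eq_mul]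
    ring

lemma ae_centeredPoissonLaw_ge {y : ℝ} (hy : 0 ≤ y) (θ : ℝ) :
    ∀ᵐ z ∂(centeredPoissonLaw θ y), -(y * θ) ≤ z := by
  rw [centeredPoissonLaw, ae_map_iff .of_discrete measurableSet_Ici]
  refine ae_of_all _ fun n => ?_
  have : 0 ≤ y * (n : ℝ) := by positivity
  linarith

end Poisson

lemma gaussPoissonLaw_exp {v θ : ℝ} (hv : 0 ≤ v) (hθ : 0 ≤ θ) (l y : ℝ) :
    Integrable (fun z => exp (l * z)) (gaussPoissonLaw v θ y) ∧
      ∫ z, exp (l * z) ∂(gaussPoissonLaw v θ y) =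
        exp (l ^ 2 * v / 2 + θ * (exp (l * y) - 1 - l * y)) := by
  obtain ⟨hiP, heP⟩ := centeredPoisson_exp hθ l y
  have hm : Measurable fun p : ℝ × ℕ => p.1 + y * ((p.2 : ℝ) - θ) := by fun_prop
  have heq : (fun p : ℝ × ℕ => exp (l * (p.1 + y * ((p.2 : ℝ) - θ)))) =
      fun p => exp (l * p.1) * exp (l * (y * ((p.2 : ℝ) - θ))) := by
    ext p; rw [← exp_add]; ring_nf
  constructor
  · refine (integrable_map_measure (by fun_prop) hm.aemeasurable).2 ?_
    change Integrable (fun p : ℝ × ℕ => exp (l * (p.1 + y * ((p.2 : ℝ) - θ)))) _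
    rw [heq]
    exact (integrable_exp_mul_gaussianReal l).mul_prod hiP
  · rw [gaussPoissonLaw, integral_map hm.aemeasurable (by fun_prop), heq,
      integral_prod_mul (fun u : ℝ => exp (l * u))
        (fun n : ℕ => exp (l * (y * ((n : ℝ) - θ)))), heP, exp_add]
    congr 1
    have h := congrFun (mgf_fun_id_gaussianReal (μ := 0) (v := v.toNNReal)) l
    rw [mgf] at h
    rw [h, coe_toNNReal v hv]
    ring_nf

/-- The exponent of the Bennett–Hoeffding bound is the Poisson log-moment generating function
evaluated at its optimal point. -/
lemma exists_BH_eq {σ y x : ℝ} (hσ : 0 < σ) (hy : 0 < y) (hx : 0 < x) :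
    ∃ l : ℝ, 0 < l ∧
      BH σ y x = exp (-l * x + σ ^ 2 / y ^ 2 * (exp (l * y) - 1 - l * y)) := by
  have hw : 0 < x * y / σ ^ 2 := by positivity
  refine ⟨log (1 + x * y / σ ^ 2) / y, div_pos (log_pos (by linarith)) hy, ?_⟩
  rw [BH, psiBH, div_mul_cancel₀ _ hy.ne', exp_log (by linarith)]
  congr 1
  field_simp
  ring

lemma Pin_le_PU {σ y ε : ℝ} (hε0 : 0 < ε) (hε1 : ε < 1) (x : ℝ) :
    Pin σ y ε x ≤ PU σ y ε x := by
  have : Nonempty (Set.Ioi (0 : ℝ)) := Set.nonempty_Ioi.to_subtype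
  refine le_ciInf fun ⟨l, hl⟩ => ?_
  obtain ⟨hi, he⟩ := gaussPoissonLaw_exp (v := (1 - ε) * σ ^ 2) (θ := ε * σ ^ 2 / y ^ 2)
    (mul_nonneg (by linarith) (sq_nonneg _)) (by positivity) l y
  refine (Ptail_le_exp (by norm_num) hl hi).trans (le_of_eq ?_)
  rw [he, ← exp_add]
  congr 1
  ring

lemma PU_le_BH {σ y ε x : ℝ} (hσ : 0 < σ) (hy : 0 < y) (hε1 : ε < 1) (hx : 0 < x) :
    PU σ y ε x ≤ BH σ y x := by
  obtain ⟨l, hl, hBH⟩ := exists_BH_eq hσ hy hx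
  rw [hBH]
  refine (ciInf_le ⟨0, by rintro _ ⟨s, rfl⟩; exact (exp_pos _).le⟩
    (⟨l, hl⟩ : Set.Ioi (0 : ℝ))).trans (exp_le_exp.2 ?_)
  have hq := quadratic_le_exp_of_nonneg (mul_pos hl hy).le
  have hc : l ^ 2 / 2 ≤ (exp (l * y) - 1 - l * y) / y ^ 2 := by
    rw [le_div_iff₀ (by positivity)]
    linarith
  have hk := mul_le_mul_of_nonneg_left hc
    (mul_nonneg (sub_nonneg.2 hε1.le) (sq_nonneg σ))
  have hsplit : σ ^ 2 / y ^ 2 * (exp (l * y) - 1 - l * y) =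
      (1 - ε) * σ ^ 2 * ((exp (l * y) - 1 - l * y) / y ^ 2) +
        (exp (l * y) - 1 - l * y) / y ^ 2 * (ε * σ ^ 2) := by ring
  change -l * x + l ^ 2 * (1 - ε) * σ ^ 2 / 2 +
    (exp (l * y) - 1 - l * y) / y ^ 2 * (ε * σ ^ 2) ≤ _
  rw [hsplit]
  linarith

lemma Be_le_BH {σ y x : ℝ} (hσ : 0 < σ) (hy : 0 < y) (hx : 0 < x) :
    Be σ y x ≤ BH σ y x := by
  obtain ⟨l, hl, hBH⟩ := exists_BH_eq hσ hy hx
  have hθ : 0 ≤ σ ^ 2 / y ^ 2 := by positivity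
  refine (Ptail_le_exp two_pos hl (integrable_exp_centeredPoissonLaw hθ l y)).trans (le_of_eq ?_)
  rw [integral_exp_centeredPoissonLaw hθ, ← exp_add, hBH]

lemma Be_le_Ca {σ y x : ℝ} (hσ : 0 < σ) (hy : 0 < y) (hx : 0 ≤ x) :
    Be σ y x ≤ Ca σ x := by
  have hθ : 0 ≤ σ ^ 2 / y ^ 2 := by positivity
  obtain ⟨hi1, h1⟩ := centeredPoissonLaw_mean hθ y
  obtain ⟨hi2, h2⟩ := centeredPoissonLaw_sq hθ y
  rw [mul_div_cancel₀ _ (by positivity)] at h2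
  exact Ptail_two_le_Ca hi1 hi2 h1 h2 hσ hx

lemma Ca_le_Be {σ y x : ℝ} (hσ : 0 < σ) (hy : 0 < y) (hx : 0 ≤ x) (hxy : x ≤ y) :
    Ca σ x ≤ Be σ y x := by
  have hθ : 0 ≤ σ ^ 2 / y ^ 2 := by positivity
  obtain ⟨hi1, h1⟩ := centeredPoissonLaw_mean hθ y
  obtain ⟨hi2, h2⟩ := centeredPoissonLaw_sq hθ y
  rw [mul_div_cancel₀ _ (by positivity)] at h2
  refine Ca_le_Ptail_two hi1 hi2 h1 h2 hσ ?_
  filter_upwards [ae_centeredPoissonLaw_ge hy.le (σ ^ 2 / y ^ 2)] with z hz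
  have hxz := mul_le_mul_of_nonneg_left hz hx
  have hs : x * (y * (σ ^ 2 / y ^ 2)) ≤ σ ^ 2 := by
    calc x * (y * (σ ^ 2 / y ^ 2)) ≤ y * (y * (σ ^ 2 / y ^ 2)) := by gcongr
      _ = σ ^ 2 := by field_simp
  linarith

end

/-- Comparison of the four bounds: `Pin ≤ PU ≤ BH`, `Be ≤ min(Ca, BH)`, and `Be = Ca`
on `[0, y]`. -/
theorem bounds_comparison (σ y ε x : ℝ)
    (hσ : 0 < σ) (hy : 0 < y) (hε0 : 0 < ε) (hε1 : ε < 1) (hx : 0 < x) :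
    (Pin σ y ε x ≤ PU σ y ε x ∧ PU σ y ε x ≤ BH σ y x ∧
      Be σ y x ≤ min (Ca σ x) (BH σ y x)) ∧
    (∀ x' ∈ Set.Icc (0 : ℝ) y, Be σ y x' = Ca σ x') := by
  exact ⟨⟨Pin_le_PU hε0 hε1 x, PU_le_BH hσ hy hε1 hx,
    le_min (Be_le_Ca hσ hy hx.le) (Be_le_BH hσ hy hx)⟩,
    fun _ hx' => le_antisymm (Be_le_Ca hσ hy hx'.1) (Ca_le_Be hσ hy hx'.1 hx'.2)⟩
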